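/- For finite metric spaces (X,d_X) and (Y,d_Y), the dissimilarity d̂((X,d_X),(Y,d_Y)) = inf_{ψ∈𝒮} d_GH((X,ψ∘d_X),(Y,d_Y)) + inf_{ψ∈𝒮} d_GH((X,d_X),(Y,ψ∘d_Y)) equals 0 if and only if (X,d_X) and (Y,d_Y) are weakly isometric. -/

import Mathlib

open scoped NNReal

def WeaklyIsometric (X Y : Type*) [MetricSpace X] [MetricSpace Y] : Prop :=
  ∃ (φ : X ≃ Y) (ψ : ℝ≥0 → ℝ≥0), StrictMono ψ ∧
    ∀ x₁ x₂ : X, ψ (nndist x₁ x₂) = nndist (φ x₁) (φ x₂)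

/-- A correspondence between `X` and `Y`: a subset of `X × Y` whose projections onto both
factors are surjective. -/
def IsCorrespondence {X Y : Type*} (C : Set (X × Y)) : Prop :=
  (∀ x : X, ∃ y : Y, (x, y) ∈ C) ∧ (∀ y : Y, ∃ x : X, (x, y) ∈ C)

/-- The distortion of a correspondence with respect to two "distance" functions. -/
noncomputable def distortion {X Y : Type*} (C : Set (X × Y))
    (eX : X → X → ℝ) (eY : Y → Y → ℝ) : ℝ :=
  sSup {r : ℝ | ∃ p ∈ C, ∃ q ∈ C, r = |eX p.1 q.1 - eY p.2 q.2|}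

/-- Gromov–Hausdorff distance: half the infimum of the distortion over all correspondences. -/
noncomputable def ghDist {X Y : Type*} (eX : X → X → ℝ) (eY : Y → Y → ℝ) : ℝ :=
  (1 / 2) * sInf {r : ℝ | ∃ C : Set (X × Y), IsCorrespondence C ∧ r = distortion C eX eY}

/-- The dissimilarity measure `d̂` between two finite metric spaces. -/
noncomputable def dhat (X Y : Type*) [MetricSpace X] [MetricSpace Y] : ℝ :=
  sInf {r : ℝ | ∃ ψ : ℝ≥0 → ℝ≥0, StrictMono ψ ∧ ψ 0 = 0 ∧
      r = ghDist (fun x₁ x₂ : X => (ψ (nndist x₁ x₂) : ℝ)) (fun y₁ y₂ : Y => dist y₁ y₂)} +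
  sInf {r : ℝ | ∃ ψ : ℝ≥0 → ℝ≥0, StrictMono ψ ∧ ψ 0 = 0 ∧
      r = ghDist (fun x₁ x₂ : X => dist x₁ x₂) (fun y₁ y₂ : Y => (ψ (nndist y₁ y₂) : ℝ))}

/-- Finitely many real numbers admit a positive lower bound for the positive ones among them. -/
theorem exists_pos_le_of_pos {ι : Type*} [Finite ι] (w : ι → ℝ) :
    ∃ ε : ℝ, 0 < ε ∧ ∀ i, 0 < w i → ε ≤ w i := by
  have h : ∀ᶠ ε in nhdsWithin (0 : ℝ) (Set.Ioi 0), ∀ i, 0 < w i → ε ≤ w i := by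
    refine Filter.eventually_all.2 fun i => ?_
    by_cases hi : 0 < w i
    · filter_upwards [Ioo_mem_nhdsGT hi] with ε hε _ using hε.2.le
    · exact Filter.Eventually.of_forall fun _ h => absurd h hi
  obtain ⟨ε, h, hε⟩ := (h.and self_mem_nhdsWithin).exists
  exact ⟨ε, hε, h⟩

/-- A strictly increasing assignment on finitely many points of `ℝ≥0`, fixing `0`, extends to a
strictly increasing function. -/
theorem exists_strictMono_extension {ι : Type*} [Finite ι] (u v : ι → ℝ≥0)
    (hlt : ∀ i j, u i < u j → v i < v j) (heq : ∀ i j, u i = u j → v i = v j)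
    (h0 : ∃ i, u i = 0 ∧ v i = 0) :
    ∃ g : ℝ≥0 → ℝ≥0, StrictMono g ∧ ∀ i, g (u i) = v i := by
  obtain ⟨ε, hε, hc⟩ := exists_pos_le_of_pos
    fun p : ι × ι => ((v p.2 : ℝ) - v p.1) / ((u p.2 : ℝ) - u p.1)
  lift ε to ℝ≥0 using hε.le
  have slope : ∀ i j, u i ≤ u j → v i + ε * u j ≤ v j + ε * u i := by
    intro i j hij
    rcases hij.eq_or_lt with h | h
    · rw [heq i j h, h]
    · have hu : (0 : ℝ) < u j - u i := sub_pos.2 (NNReal.coe_lt_coe.2 h)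
      have hv : (0 : ℝ) < v j - v i := sub_pos.2 (NNReal.coe_lt_coe.2 (hlt i j h))
      have := (le_div_iff₀ hu).1 (hc (i, j) (div_pos hv hu))
      rw [← NNReal.coe_le_coe]
      push_cast
      linarith
  obtain ⟨i₀, hu₀, hv₀⟩ := h0
  have below : ∀ i, ε * u i ≤ v i := fun i => by
    simpa [hu₀, hv₀] using slope i₀ i (by simp [hu₀])
  let M : ℝ≥0 → ℝ≥0 := fun t => ⨆ i : {i // u i ≤ t}, (v i - ε * u i)
  have bdd : ∀ t, BddAbove (Set.range fun i : {i // u i ≤ t} => v i - ε * u i) :=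
    fun t => (Set.finite_range _).bddAbove
  have hM : Monotone M := by
    intro s t hst
    have : Nonempty {i // u i ≤ s} := ⟨⟨i₀, by simp [hu₀]⟩⟩
    exact ciSup_le fun i => le_ciSup (bdd t) ⟨i.1, i.2.trans hst⟩
  refine ⟨fun t => M t + ε * t, fun s t hst => ?_, fun i => ?_⟩
  · exact add_lt_add_of_le_of_lt (hM hst.le)
      (mul_lt_mul_of_pos_left hst (NNReal.coe_pos.1 hε))
  · have hMi : M (u i) = v i - ε * u i := by
      refine le_antisymm ?_ (le_ciSup (bdd (u i)) ⟨i, le_rfl⟩)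
      have : Nonempty {j // u j ≤ u i} := ⟨⟨i, le_rfl⟩⟩
      refine ciSup_le fun j => ?_
      rw [tsub_le_iff_right, ← NNReal.coe_le_coe]
      have h₁ := NNReal.coe_le_coe.2 (slope j i j.2)
      have h₂ := NNReal.coe_sub (below i)
      push_cast at h₁ h₂ ⊢
      linarith
    simp only [hMi]
    exact tsub_add_cancel_of_le (below i)

/-- Weak isometry of nonempty finite metric spaces is symmetric. -/
theorem WeaklyIsometric.symm {X Y : Type*} [MetricSpace X] [MetricSpace Y] [Finite Y]
    [Nonempty Y] (h : WeaklyIsometric X Y) : WeaklyIsometric Y X := by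
  obtain ⟨φ, ψ, hψ, h⟩ := h
  have h' : ∀ p : Y × Y, nndist p.1 p.2 = ψ (nndist (φ.symm p.1) (φ.symm p.2)) := by
    intro p
    simp [h]
  obtain ⟨g, hg, hgu⟩ := exists_strictMono_extension (fun p : Y × Y => nndist p.1 p.2)
    (fun p => nndist (φ.symm p.1) (φ.symm p.2))
    (fun i j hij => by rwa [h', h', hψ.lt_iff_lt] at hij)
    (fun i j hij => by rwa [h', h', hψ.injective.eq_iff] at hij)
    ⟨(Classical.arbitrary Y, Classical.arbitrary Y), by simp⟩
  exact ⟨φ.symm, g, hg, fun y₁ y₂ => hgu (y₁, y₂)⟩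

theorem distortion_nonneg {X Y : Type*} (C : Set (X × Y)) (eX : X → X → ℝ) (eY : Y → Y → ℝ) :
    0 ≤ distortion C eX eY :=
  Real.sSup_nonneg (by rintro _ ⟨p, _, q, _, rfl⟩; exact abs_nonneg _)

theorem abs_sub_le_distortion {X Y : Type*} [Finite X] [Finite Y] {C : Set (X × Y)}
    (eX : X → X → ℝ) (eY : Y → Y → ℝ) {p q : X × Y} (hp : p ∈ C) (hq : q ∈ C) :
    |eX p.1 q.1 - eY p.2 q.2| ≤ distortion C eX eY := by
  refine le_csSup (Set.Finite.bddAbove ?_) ⟨p, hp, q, hq, rfl⟩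
  refine (Set.finite_range fun r : (X × Y) × (X × Y) =>
    |eX r.1.1 r.2.1 - eY r.1.2 r.2.2|).subset ?_
  rintro _ ⟨p, _, q, _, rfl⟩
  exact ⟨(p, q), rfl⟩

theorem IsCorrespondence.swap {X Y : Type*} {C : Set (X × Y)} (hC : IsCorrespondence C) :
    IsCorrespondence (Prod.swap ⁻¹' C) :=
  ⟨hC.2, hC.1⟩

theorem distortion_swap {X Y : Type*} (C : Set (X × Y)) (eX : X → X → ℝ) (eY : Y → Y → ℝ) :
    distortion (Prod.swap ⁻¹' C) eY eX = distortion C eX eY := by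
  unfold distortion
  congr 1
  ext r
  constructor
  · rintro ⟨p, hp, q, hq, rfl⟩
    exact ⟨p.swap, hp, q.swap, hq, abs_sub_comm _ _⟩
  · rintro ⟨p, hp, q, hq, rfl⟩
    exact ⟨p.swap, by simpa using hp, q.swap, by simpa using hq, abs_sub_comm _ _⟩

theorem ghDist_comm {X Y : Type*} (eX : X → X → ℝ) (eY : Y → Y → ℝ) :
    ghDist eX eY = ghDist eY eX := by
  unfold ghDist
  congr 2
  ext r
  constructor
  · rintro ⟨C, hC, rfl⟩
    exact ⟨_, hC.swap, (distortion_swap C eX eY).symm⟩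
  · rintro ⟨C, hC, rfl⟩
    exact ⟨_, hC.swap, (distortion_swap C eY eX).symm⟩

theorem ghDist_nonneg {X Y : Type*} (eX : X → X → ℝ) (eY : Y → Y → ℝ) : 0 ≤ ghDist eX eY :=
  mul_nonneg (by norm_num)
    (Real.sInf_nonneg (by rintro _ ⟨C, _, rfl⟩; exact distortion_nonneg C eX eY))

theorem ghDist_eq_zero_of_equiv {X Y : Type*} {eX : X → X → ℝ} {eY : Y → Y → ℝ} (φ : X ≃ Y)
    (h : ∀ x₁ x₂, eX x₁ x₂ = eY (φ x₁) (φ x₂)) : ghDist eX eY = 0 := by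
  refine le_antisymm ?_ (ghDist_nonneg _ _)
  have hC : IsCorrespondence {p : X × Y | φ p.1 = p.2} :=
    ⟨fun x => ⟨φ x, rfl⟩, fun y => ⟨φ.symm y, φ.apply_symm_apply y⟩⟩
  have hdis : distortion {p : X × Y | φ p.1 = p.2} eX eY ≤ 0 := by
    refine Real.sSup_nonpos ?_
    rintro _ ⟨p, hp, q, hq, rfl⟩
    rw [h, show φ p.1 = p.2 from hp, show φ q.1 = q.2 from hq, sub_self, abs_zero]
  have hinf : sInf {r : ℝ | ∃ C : Set (X × Y), IsCorrespondence C ∧ r = distortion C eX eY} ≤ 0 :=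
    csInf_le_of_le ⟨0, by rintro _ ⟨C, _, rfl⟩; exact distortion_nonneg C eX eY⟩
      ⟨_, hC, rfl⟩ hdis
  unfold ghDist
  linarith

theorem exists_distortion_lt_of_ghDist_lt {X Y : Type*} [Nonempty X] [Nonempty Y]
    {eX : X → X → ℝ} {eY : Y → Y → ℝ} {ε : ℝ} (h : ghDist eX eY < ε / 2) :
    ∃ C : Set (X × Y), IsCorrespondence C ∧ distortion C eX eY < ε := by
  unfold ghDist at h
  have hne : {r : ℝ | ∃ C : Set (X × Y), IsCorrespondence C ∧ r = distortion C eX eY}.Nonempty :=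
    ⟨_, Set.univ, ⟨fun _ => ⟨Classical.arbitrary Y, trivial⟩,
      fun _ => ⟨Classical.arbitrary X, trivial⟩⟩, rfl⟩
  obtain ⟨_, ⟨C, hC, rfl⟩, hlt⟩ := exists_lt_of_csInf_lt hne (b := ε) (by linarith)
  exact ⟨C, hC, hlt⟩

/-- The infimal Gromov–Hausdorff distance to `Y` over all rescalings of the metric of `X`. -/
noncomputable def rescaledGHDist (X Y : Type*) [MetricSpace X] [MetricSpace Y] : ℝ :=
  sInf {r : ℝ | ∃ ψ : ℝ≥0 → ℝ≥0, StrictMono ψ ∧ ψ 0 = 0 ∧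
    r = ghDist (fun x₁ x₂ : X => (ψ (nndist x₁ x₂) : ℝ)) (fun y₁ y₂ : Y => dist y₁ y₂)}

theorem dhat_eq_add (X Y : Type*) [MetricSpace X] [MetricSpace Y] :
    dhat X Y = rescaledGHDist X Y + rescaledGHDist Y X := by
  simp only [dhat, rescaledGHDist, ghDist_comm (fun x₁ x₂ : X => dist x₁ x₂)]

theorem rescaledGHDist_nonneg (X Y : Type*) [MetricSpace X] [MetricSpace Y] :
    0 ≤ rescaledGHDist X Y :=
  Real.sInf_nonneg (by rintro _ ⟨ψ, _, _, rfl⟩; exact ghDist_nonneg _ _)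

theorem WeaklyIsometric.rescaledGHDist_eq_zero {X Y : Type*} [MetricSpace X] [MetricSpace Y]
    [Nonempty X] (h : WeaklyIsometric X Y) : rescaledGHDist X Y = 0 := by
  obtain ⟨φ, ψ, hψ, h⟩ := h
  have hψ0 : ψ 0 = 0 := by
    simpa using h (Classical.arbitrary X) (Classical.arbitrary X)
  refine le_antisymm (csInf_le ⟨0, ?_⟩ ⟨ψ, hψ, hψ0, ?_⟩) (rescaledGHDist_nonneg X Y)
  · rintro _ ⟨ψ, _, _, rfl⟩
    exact ghDist_nonneg _ _
  · exact (ghDist_eq_zero_of_equiv φ fun x₁ x₂ => by rw [h, coe_nndist]).symm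

/-- If rescalings of `X` come arbitrarily close to `Y`, some surjection `X → Y` reflects the strict
order of distances. -/
theorem exists_surjective_of_rescaledGHDist_eq_zero {X Y : Type*} [MetricSpace X] [MetricSpace Y]
    [Finite X] [Finite Y] [Nonempty X] [Nonempty Y] (h : rescaledGHDist X Y = 0) :
    ∃ φ : X → Y, Function.Surjective φ ∧ ∀ a b : X × X,
      nndist (φ a.1) (φ a.2) < nndist (φ b.1) (φ b.2) → nndist a.1 a.2 < nndist b.1 b.2 := by
  obtain ⟨ε, hε, hgap⟩ := exists_pos_le_of_pos
    fun p : (Y × Y) × (Y × Y) => dist p.2.1 p.2.2 - dist p.1.1 p.1.2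
  obtain ⟨_, ⟨ψ, hψ, hψ0, rfl⟩, hlt⟩ := exists_lt_of_csInf_lt
    (s := {r : ℝ | ∃ ψ : ℝ≥0 → ℝ≥0, StrictMono ψ ∧ ψ 0 = 0 ∧
      r = ghDist (fun x₁ x₂ : X => (ψ (nndist x₁ x₂) : ℝ)) (fun y₁ y₂ : Y => dist y₁ y₂)})
    (b := ε / 2 / 2) ⟨_, id, strictMono_id, rfl, rfl⟩ (h.trans_lt (by positivity))
  obtain ⟨C, hC, hdis⟩ := exists_distortion_lt_of_ghDist_lt hlt
  have close : ∀ p ∈ C, ∀ q ∈ C, |(ψ (nndist p.1 q.1) : ℝ) - dist p.2 q.2| < ε / 2 :=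
    fun p hp q hq => (abs_sub_le_distortion (fun x₁ x₂ : X => (ψ (nndist x₁ x₂) : ℝ))
      (fun y₁ y₂ : Y => dist y₁ y₂) hp hq).trans_lt hdis
  choose φ hφ using hC.1
  refine ⟨φ, fun y => ?_, fun a b hab => ?_⟩
  · obtain ⟨x, hx⟩ := hC.2 y
    refine ⟨x, by_contra fun hne => ?_⟩
    have h₁ := close _ (hφ x) _ hx
    have h₂ := hgap ((y, y), (φ x, y)) (by simpa using hne)
    simp only [nndist_self, hψ0, NNReal.coe_zero, zero_sub, abs_neg, abs_dist, dist_self,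
      sub_zero] at h₁ h₂
    linarith
  · have h₁ := abs_lt.1 (close _ (hφ a.1) _ (hφ a.2))
    have h₂ := abs_lt.1 (close _ (hφ b.1) _ (hφ b.2))
    have h₃ := hgap ((φ a.1, φ a.2), (φ b.1, φ b.2)) (sub_pos.2 (by exact_mod_cast hab))
    rw [← hψ.lt_iff_lt, ← NNReal.coe_lt_coe]
    simp only at h₁ h₂ h₃
    linarith [h₁.2, h₂.1]

/-- A bijection reflecting the strict order of distances bounds the number of strictly ordered
pairs of distances. -/
theorem card_lt_pairs_le {X Y : Type*} [MetricSpace X] [MetricSpace Y] [Finite X]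
    (φ : X ≃ Y) (hφ : ∀ a b : X × X,
      nndist (φ a.1) (φ a.2) < nndist (φ b.1) (φ b.2) → nndist a.1 a.2 < nndist b.1 b.2) :
    {p : (Y × Y) × (Y × Y) | nndist p.1.1 p.1.2 < nndist p.2.1 p.2.2}.ncard ≤
      {p : (X × X) × (X × X) | nndist p.1.1 p.1.2 < nndist p.2.1 p.2.2}.ncard := by
  let e := (φ.symm.prodCongr φ.symm).prodCongr (φ.symm.prodCongr φ.symm)
  refine Set.ncard_le_ncard_of_injOn e (fun p hp => hφ _ _ ?_) e.injective.injOn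
    (Set.toFinite _)
  simpa [e] using hp

/-- If two finite metric spaces admit bijections both ways reflecting the strict order of
distances, each such bijection also preserves it. -/
theorem nndist_lt_of_reflects {X Y : Type*} [MetricSpace X] [MetricSpace Y] [Finite X] [Finite Y]
    (φ : X ≃ Y) (hφ : ∀ a b : X × X,
      nndist (φ a.1) (φ a.2) < nndist (φ b.1) (φ b.2) → nndist a.1 a.2 < nndist b.1 b.2)
    (χ : Y ≃ X) (hχ : ∀ a b : Y × Y,
      nndist (χ a.1) (χ a.2) < nndist (χ b.1) (χ b.2) → nndist a.1 a.2 < nndist b.1 b.2)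
    (a b : X × X) (hab : nndist a.1 a.2 < nndist b.1 b.2) :
    nndist (φ a.1) (φ a.2) < nndist (φ b.1) (φ b.2) := by
  let e := (φ.prodCongr φ).prodCongr (φ.prodCongr φ)
  let S := {p : (X × X) × (X × X) | nndist p.1.1 p.1.2 < nndist p.2.1 p.2.2}
  let T := {p : (Y × Y) × (Y × Y) | nndist p.1.1 p.1.2 < nndist p.2.1 p.2.2}
  have hcard : S.ncard ≤ (e ⁻¹' T).ncard := by
    rw [Set.ncard_preimage_of_injective_subset_range e.injective (by simp)]
    exact card_lt_pairs_le χ hχ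
  have hsub : e ⁻¹' T ⊆ S := fun p hp => hφ p.1 p.2 hp
  have heq : e ⁻¹' T = S := Set.eq_of_subset_of_ncard_le hsub hcard (Set.toFinite _)
  have hmem : (a, b) ∈ e ⁻¹' T := heq ▸ hab
  exact hmem

theorem weaklyIsometric_of_rescaledGHDist_eq_zero {X Y : Type*} [MetricSpace X] [MetricSpace Y]
    [Finite X] [Finite Y] [Nonempty X] [Nonempty Y]
    (hXY : rescaledGHDist X Y = 0) (hYX : rescaledGHDist Y X = 0) : WeaklyIsometric X Y := by
  obtain ⟨φ, hφs, hφ⟩ := exists_surjective_of_rescaledGHDist_eq_zero hXY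
  obtain ⟨χ, hχs, hχ⟩ := exists_surjective_of_rescaledGHDist_eq_zero hYX
  have hcard : Nat.card X = Nat.card Y :=
    le_antisymm (Nat.card_le_card_of_surjective χ hχs) (Nat.card_le_card_of_surjective φ hφs)
  let Φ := Equiv.ofBijective φ (hφs.bijective_of_nat_card_le hcard.le)
  let Χ := Equiv.ofBijective χ (hχs.bijective_of_nat_card_le hcard.ge)
  have hlt := nndist_lt_of_reflects Φ hφ Χ hχ
  obtain ⟨g, hg, hgu⟩ := exists_strictMono_extension (fun p : X × X => nndist p.1 p.2)
    (fun p => nndist (Φ p.1) (Φ p.2)) hlt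
    (fun a b hab => le_antisymm (not_lt.1 fun h => (hφ b a h).ne' hab)
      (not_lt.1 fun h => (hφ a b h).ne hab))
    ⟨(Classical.arbitrary X, Classical.arbitrary X), by simp⟩
  exact ⟨Φ, g, hg, fun x₁ x₂ => hgu (x₁, x₂)⟩

/-- `d̂` vanishes exactly on weakly isometric pairs of finite metric spaces. -/
theorem dhat_eq_zero_iff_weaklyIsometric (X Y : Type*)
    [MetricSpace X] [MetricSpace Y] [Fintype X] [Fintype Y] [Nonempty X] [Nonempty Y] :
    dhat X Y = 0 ↔ WeaklyIsometric X Y := by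
  rw [dhat_eq_add, add_eq_zero_iff_of_nonneg (rescaledGHDist_nonneg X Y)
    (rescaledGHDist_nonneg Y X)]
  exact ⟨fun h => weaklyIsometric_of_rescaledGHDist_eq_zero h.1 h.2,
    fun h => ⟨h.rescaledGHDist_eq_zero, h.symm.rescaledGHDist_eq_zero⟩⟩
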